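/- arXiv:2604.22243 — 6 statements merged into one kernel-verified Lean document; each statement's English description precedes it below -/
import Mathlib

section
/- Let A and A' be two N×N Cartan matrices. Then A and A' are equivalent (i.e., A' = D A D^{-1} for some diagonal matrix D with strictly positive diagonal entries) if and only if all their cyclic products are equal, that is, for every k ≥ 1 and every k-tuple C = (i_1, …, i_k) of indices in {1,…,N}, one has a_{i_1 i_2} a_{i_2 i_3} ⋯ a_{i_k i_1} = a'_{i_1 i_2} a'_{i_2 i_3} ⋯ a'_{i_k i_1}. -/
open scoped BigOperators

/-- A Cartan matrix: `2` on the diagonal, nonpositive off-diagonal entries,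
`a_{ij} = 0` iff `a_{ji} = 0`, and for each pair `i ≠ j` with `a_{ij} ≠ 0`,
either `a_{ij}a_{ji} ≥ 4` or `a_{ij}a_{ji} = 4cos²(π/m)` for some integer `m ≥ 3`. -/
def IsCartanMatrix {N : ℕ} (A : Matrix (Fin N) (Fin N) ℝ) : Prop :=
  (∀ i, A i i = 2) ∧
  (∀ i j, i ≠ j → A i j ≤ 0) ∧
  (∀ i j, A i j = 0 ↔ A j i = 0) ∧
  (∀ i j, i ≠ j → A i j ≠ 0 →
    4 ≤ A i j * A j i ∨ ∃ m : ℕ, 3 ≤ m ∧ A i j * A j i = 4 * Real.cos (Real.pi / m) ^ 2)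

namespace SimpleGraph.Walk

variable {V K : Type*} {G : SimpleGraph V}

/-- The product of `r x y` over the successive darts `(x, y)` of a walk. -/
def weight [CommMonoid K] (r : V → V → K) : {u v : V} → G.Walk u v → K
  | _, _, .nil => 1
  | u, _, .cons (v := v) _ p => r u v * p.weight r

theorem weight_append [CommMonoid K] (r : V → V → K) {u v w : V}
    (p : G.Walk u v) (q : G.Walk v w) :
    (p.append q).weight r = p.weight r * q.weight r := by
  induction p with
  | nil => simp [weight]
  | cons h p ih => simp [weight, ih, mul_assoc]

theorem weight_eq_prod_range [CommMonoid K] (r : V → V → K) {u v : V} (p : G.Walk u v) :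
    p.weight r = ∏ t ∈ Finset.range p.length, r (p.getVert t) (p.getVert (t + 1)) := by
  induction p with
  | nil => simp [weight]
  | cons h p ih => simp [weight, ih, Finset.prod_range_succ', mul_comm]

theorem weight_pos [Field K] [LinearOrder K] [IsStrictOrderedRing K] {r : V → V → K}
    (hr : ∀ i j, G.Adj i j → 0 < r i j) {u v : V} (p : G.Walk u v) : 0 < p.weight r := by
  induction p with
  | nil => simp [weight]
  | cons h p ih => exact mul_pos (hr _ _ h) ih

theorem weight_div [Field K] (r s : V → V → K) {u v : V} (p : G.Walk u v) :
    p.weight (fun i j => r i j / s i j) = p.weight r / p.weight s := by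
  induction p with
  | nil => simp [weight]
  | cons h p ih => simp [weight, ih, mul_div_mul_comm]

theorem weight_ne_zero [Field K] {r : V → V → K} (hr : ∀ i j, G.Adj i j → r i j ≠ 0)
    {u v : V} (p : G.Walk u v) : p.weight r ≠ 0 := by
  induction p with
  | nil => simp [weight]
  | cons h p ih => exact mul_ne_zero (hr _ _ h) ih

/-- The weight of a nonempty closed walk is a cyclic product. -/
theorem weight_eq_cyclic_prod [CommMonoid K] (r : V → V → K) {u : V} (p : G.Walk u u) {k : ℕ}
    (hk : p.length = k + 1) :
    p.weight r = ∏ j : Fin (k + 1), r (p.getVert j) (p.getVert (j + 1 : Fin (k + 1))) := by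
  rw [weight_eq_prod_range, hk, Finset.prod_range]
  refine Finset.prod_congr rfl fun j _ => ?_
  obtain rfl | hj := eq_or_ne j (Fin.last k)
  · have h : p.getVert (k + 1) = u := hk ▸ p.getVert_length
    simp [h]
  · rw [Fin.val_add_one_of_lt (Fin.lt_last_iff_ne_last.mpr hj)]

theorem weight_eq_of_cyclic_prod_eq [CommMonoid K] {r s : V → V → K}
    (h : ∀ (k : ℕ) (C : Fin (k + 1) → V),
      ∏ j, r (C j) (C (j + 1)) = ∏ j, s (C j) (C (j + 1)))
    {u : V} (p : G.Walk u u) : p.weight r = p.weight s := by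
  rcases hk : p.length with _ | k
  · simp [weight_eq_prod_range, hk]
  · rw [p.weight_eq_cyclic_prod r hk, p.weight_eq_cyclic_prod s hk]
    exact h k fun j => p.getVert j

end SimpleGraph.Walk

/-- A positive edge weighting whose closed walks all have weight one comes from a positive
multiplicative potential on the vertices. -/
theorem SimpleGraph.exists_pos_potential {V K : Type*} [Field K] [LinearOrder K]
    [IsStrictOrderedRing K] (G : SimpleGraph V) (r : V → V → K)
    (hr : ∀ i j, G.Adj i j → 0 < r i j) (hc : ∀ u (p : G.Walk u u), p.weight r = 1) :
    ∃ d : V → K, (∀ i, 0 < d i) ∧ ∀ i j, G.Adj i j → d i = r i j * d j := by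
  have weight_eq : ∀ {u v v' : V} (p : G.Walk u v) (q : G.Walk u v'), v = v' →
      p.weight r = q.weight r := by
    rintro u v _ p q rfl
    have hp := hc _ (p.append q.reverse)
    have hq := hc _ (q.append q.reverse)
    rw [Walk.weight_append] at hp hq
    exact mul_right_cancel₀ (Walk.weight_pos hr q.reverse).ne' (hp.trans hq.symm)
  have reach (i : V) : G.Reachable i (G.connectedComponentMk i).out :=
    (ConnectedComponent.exact (Quot.out_eq _)).symm
  let w (i : V) := (reach i).some
  refine ⟨fun i => (w i).weight r, fun i => Walk.weight_pos hr _, fun i j h => ?_⟩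
  refine weight_eq (w i) (Walk.cons h (w j)) ?_
  rw [ConnectedComponent.sound h.reachable]

theorem prod_diagonal_conj_cyclic {V K : Type*} [Field K] (A : Matrix V V K) (d : V → K)
    (hd : ∀ i, d i ≠ 0) (k : ℕ) (C : Fin (k + 1) → V) :
    ∏ j, d (C j) * A (C j) (C (j + 1)) * (d (C (j + 1)))⁻¹ = ∏ j, A (C j) (C (j + 1)) := by
  have h : ∏ j, d (C (j + 1)) = ∏ j, d (C j) :=
    Equiv.prod_comp (Equiv.addRight 1) fun j => d (C j)
  rw [Finset.prod_mul_distrib, Finset.prod_mul_distrib, Finset.prod_inv_distrib, h,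
    mul_right_comm, mul_inv_cancel₀ (Finset.prod_ne_zero_iff.mpr fun j _ => hd (C j)), one_mul]

/-- Vinberg, Proposition 16. Two `N × N` Cartan matrices are
equivalent (conjugate by a positive diagonal matrix) if and only if all their
cyclic products agree: for every `k ≥ 1` and every `k`-tuple
`C = (i₁, …, i_k)` of indices, `a_{i₁ i₂} a_{i₂ i₃} ⋯ a_{i_k i₁} =
a'_{i₁ i₂} a'_{i₂ i₃} ⋯ a'_{i_k i₁}`. -/
theorem cartan_equivalent_iff_cyclic_products_eq {N : ℕ}
    (A A' : Matrix (Fin N) (Fin N) ℝ)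
    (hA : IsCartanMatrix A) (hA' : IsCartanMatrix A') :
    (∃ d : Fin N → ℝ, (∀ i, 0 < d i) ∧
        ∀ i j, A' i j = d i * A i j * (d j)⁻¹) ↔
    (∀ (k : ℕ) (C : Fin (k + 1) → Fin N),
        ∏ j : Fin (k + 1), A (C j) (C (j + 1)) =
        ∏ j : Fin (k + 1), A' (C j) (C (j + 1))) := by
  constructor
  · rintro ⟨d, hd, h⟩ k C
    exact (prod_diagonal_conj_cyclic A d (fun i => (hd i).ne') k C).symm.trans
      (Finset.prod_congr rfl fun j _ => (h _ _).symm)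
  · intro h
    obtain ⟨diagA, nonposA, symmA, -⟩ := hA
    obtain ⟨diagA', nonposA', symmA', -⟩ := hA'
    have zero_iff (i j : Fin N) : A i j = 0 ↔ A' i j = 0 := by
      have h2 : A i j * A j i = A' i j * A' j i :=
        (Fin.prod_univ_two _).symm.trans ((h 1 ![i, j]).trans (Fin.prod_univ_two _))
      have := symmA i j
      have := symmA' i j
      grind
    let G : SimpleGraph (Fin N) :=
      { Adj := fun i j => i ≠ j ∧ A i j ≠ 0
        symm := ⟨fun i j hij => ⟨hij.1.symm, fun h0 => hij.2 ((symmA i j).2 h0)⟩⟩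
        loopless := ⟨fun i hi => hi.1 rfl⟩ }
    have negA (i j : Fin N) (hij : G.Adj i j) : A i j < 0 :=
      lt_of_le_of_ne (nonposA i j hij.1) hij.2
    have negA' (i j : Fin N) (hij : G.Adj i j) : A' i j < 0 :=
      lt_of_le_of_ne (nonposA' i j hij.1) (mt (zero_iff i j).2 hij.2)
    obtain ⟨d, hd, hdr⟩ := G.exists_pos_potential (fun i j => A' i j / A i j)
      (fun i j hij => div_pos_of_neg_of_neg (negA' i j hij) (negA i j hij)) fun u p => by
        refine (p.weight_div A' A).trans ((div_eq_one_iff_eq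
          (p.weight_ne_zero fun i j hij => (negA i j hij).ne)).2 ?_)
        exact (p.weight_eq_of_cyclic_prod_eq h).symm
    refine ⟨d, hd, fun i j => ?_⟩
    have hdj := (hd j).ne'
    obtain rfl | hij := eq_or_ne i j
    · rw [diagA, diagA']
      field_simp
    · by_cases h0 : A i j = 0
      · simp [h0, (zero_iff i j).1 h0]
      · rw [hdr i j ⟨hij, h0⟩]
        field_simp
end

section
/- Let n ≥ 1, let S be a finite index set, and for each s ∈ S let b_s ∈ ℝⁿ and α_s ∈ ℝⁿ, and set σ_s = Idₙ − b_s α_sᵀ (an n×n real matrix). Suppose there exists an invertible matrix g ∈ GL(n, ℝ) such that for every s ∈ S, all entries of g σ_s g^{-1} are integers. Then for every k ≥ 1 and every k-tuple (s_1, …, s_k) of elements of S, the cyclic product ⟨α_{s_1}, b_{s_2}⟩ ⟨α_{s_2}, b_{s_3}⟩ ⋯ ⟨α_{s_k}, b_{s_1}⟩ is an integer, where ⟨α, b⟩ denotes the standard pairing Σ_p α_p b_p. -/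
open scoped BigOperators

open Matrix in
/-- If all the rank-one matrices `vecMulVec (c i) (a i)` have entries in a subring, then so does the
product of the pairings `a i ⬝ᵥ c (e i)` along a permutation `e`. -/
theorem Subring.prod_dotProduct_perm_mem {A ι m : Type*} [CommRing A] [Fintype ι] [Fintype m]
    (R : Subring A) (c a : ι → m → A) (e : Equiv.Perm ι)
    (h : ∀ i p q, vecMulVec (c i) (a i) p q ∈ R) :
    ∏ i, a i ⬝ᵥ c (e i) ∈ R := by
  classical
  simp only [dotProduct, Finset.prod_univ_sum]
  refine R.sum_mem fun f _ => ?_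
  have key : ∏ i, a i (f i) * c (e i) (f i) =
      ∏ i, vecMulVec (c i) (a i) (f (e.symm i)) (f i) := by
    simp only [vecMulVec_apply, Finset.prod_mul_distrib]
    rw [mul_comm, ← Equiv.prod_comp e (fun i => c i (f (e.symm i)))]
    simp
  rw [key]
  exact R.prod_mem fun i _ => h i _ _

/-- forward direction of the integrality criterion,
Lemma 2.17 of the paper. If the projective reflections
`σ_s = Id − b_s α_sᵀ` are simultaneously conjugated into integer matrices by
some `g ∈ GL(n, ℝ)`, then every cyclic product
`⟨α_{s₁}, b_{s₂}⟩ ⟨α_{s₂}, b_{s₃}⟩ ⋯ ⟨α_{s_k}, b_{s₁}⟩` is an integer. -/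
theorem cyclic_products_integral_of_integral_reflections
    (n : ℕ) (hn : 1 ≤ n) (S : Type*) [Fintype S]
    (b α : S → (Fin n → ℝ))
    (g : GL (Fin n) ℝ)
    (hint : ∀ s : S, ∀ p q : Fin n, ∃ z : ℤ,
      ((g : Matrix (Fin n) (Fin n) ℝ) *
        (1 - Matrix.vecMulVec (b s) (α s)) *
        ((g⁻¹ : GL (Fin n) ℝ) : Matrix (Fin n) (Fin n) ℝ)) p q = z) :
    ∀ (k : ℕ) (t : Fin (k + 1) → S), ∃ z : ℤ,
      (∏ j : Fin (k + 1), ∑ p : Fin n, α (t j) p * b (t (j + 1)) p) = z := by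
  intro k t
  let R : Subring ℝ := (Int.castRingHom ℝ).range
  let G : Matrix (Fin n) (Fin n) ℝ := g
  let H : Matrix (Fin n) (Fin n) ℝ := (g⁻¹ : GL (Fin n) ℝ)
  have hGH : G * H = 1 := g.mul_inv
  have hHG : H * G = 1 := g.inv_mul
  have mem : ∀ s p q, Matrix.vecMulVec (G.mulVec (b s)) (Matrix.vecMul (α s) H) p q ∈ R := by
    intro s p q
    have hσ : Matrix.vecMulVec (G.mulVec (b s)) (Matrix.vecMul (α s) H) =
        1 - G * (1 - Matrix.vecMulVec (b s) (α s)) * H := by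
      rw [mul_sub, sub_mul, mul_one, hGH, Matrix.mul_vecMulVec, Matrix.vecMulVec_mul,
        sub_sub_cancel]
    rw [hσ, Matrix.sub_apply]
    refine R.sub_mem ?_ ?_
    · rw [Matrix.one_apply]
      split_ifs
      exacts [R.one_mem, R.zero_mem]
    · obtain ⟨z, hz⟩ := hint s p q
      exact ⟨z, hz.symm⟩
  obtain ⟨z, hz⟩ := R.prod_dotProduct_perm_mem (fun j => G.mulVec (b (t j)))
    (fun j => Matrix.vecMul (α (t j)) H) (Equiv.addRight 1) fun j => mem (t j)
  refine ⟨z, Eq.trans (Finset.prod_congr rfl fun j _ => ?_) hz.symm⟩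
  rw [Matrix.dotProduct_mulVec, Matrix.vecMul_vecMul, hHG, Matrix.vecMul_one]
  rfl
end

section
/- Let d ≥ 1 be a natural number and let K₁, K₂, x₁, x₂, y₁, y₂ be real numbers with K₁ ≠ 0, K₂ ≠ 0, x₁ > 0, x₂ > 0, y₁ > 0, y₂ > 0. Then the set { u ∈ ℝ : K₁·(x₁ + e^{(d+1)u}·y₁) is an integer and K₂·(x₂ + e^{−(d+1)u}·y₂) is an integer } is finite. -/
/-- On the half-line where `exp (c * u) ≤ 1`, the function `K * (x + exp (c * u) * y)` is bounded
and injective, so it takes integer values only finitely often. -/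
theorem finite_setOf_exp_affine_eq_intCast {K y c : ℝ} (x : ℝ) (hK : K ≠ 0) (hy : y ≠ 0)
    (hc : c ≠ 0) :
    {u : ℝ | c * u ≤ 0 ∧ ∃ z : ℤ, K * (x + Real.exp (c * u) * y) = z}.Finite := by
  have hinj : Function.Injective fun u : ℝ => K * (x + Real.exp (c * u) * y) := by
    intro u v huv
    simpa [hK, hy, hc] using huv
  set M : ℝ := |K| * (|x| + |y|)
  have hfin : ((fun z : ℤ => (z : ℝ)) '' Set.Icc ⌈-M⌉ ⌊M⌋).Finite :=
    (Set.finite_Icc _ _).image _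
  refine (hfin.preimage hinj.injOn).subset ?_
  rintro u ⟨hu, z, hz⟩
  have hexp : Real.exp (c * u) ≤ 1 := Real.exp_le_one_iff.mpr hu
  have hbound : |(z : ℝ)| ≤ M := by
    rw [← hz, abs_mul]
    refine mul_le_mul_of_nonneg_left ((abs_add_le _ _).trans ?_) (abs_nonneg K)
    rw [abs_mul, Real.abs_exp]
    gcongr
    exact mul_le_of_le_one_left (abs_nonneg y) hexp
  obtain ⟨hlower, hupper⟩ := abs_le.mp hbound
  exact ⟨z, ⟨Int.ceil_le.mpr hlower, Int.le_floor.mpr hupper⟩, hz.symm⟩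

/-- analytic core of Lemma 5.8 of the paper. Along a bending
fiber, the set of bending parameters `u` for which both cyclic products
`K₁(x₁ + e^{(d+1)u} y₁)` and `K₂(x₂ + e^{−(d+1)u} y₂)` are integers is finite. -/
theorem bending_integral_parameters_finite
    (d : ℕ) (hd : 1 ≤ d) (K₁ K₂ x₁ x₂ y₁ y₂ : ℝ)
    (hK₁ : K₁ ≠ 0) (hK₂ : K₂ ≠ 0)
    (hx₁ : 0 < x₁) (hx₂ : 0 < x₂) (hy₁ : 0 < y₁) (hy₂ : 0 < y₂) :
    {u : ℝ |
      (∃ z : ℤ, K₁ * (x₁ + Real.exp (((d : ℝ) + 1) * u) * y₁) = z) ∧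
      (∃ z : ℤ, K₂ * (x₂ + Real.exp (-(((d : ℝ) + 1) * u)) * y₂) = z)}.Finite := by
  have hc : (d : ℝ) + 1 ≠ 0 := by positivity
  refine ((finite_setOf_exp_affine_eq_intCast x₁ hK₁ hy₁.ne' hc).union
    (finite_setOf_exp_affine_eq_intCast x₂ hK₂ hy₂.ne' (neg_ne_zero.mpr hc))).subset ?_
  rintro u ⟨h₁, h₂⟩
  rcases le_total (((d : ℝ) + 1) * u) 0 with hu | hu
  · exact Or.inl ⟨hu, h₁⟩
  · refine Or.inr ⟨?_, ?_⟩
    · rwa [neg_mul, neg_nonpos]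
    · simpa only [neg_mul] using h₂
end

section
/- Let m₁₂, m₁₃, m₂₃ be natural numbers each ≥ 3, write c_{ij} = cos(π/m_{ij}), and for x > 0 define the 3×3 real matrix A(x) with rows (2, −2c₁₂, −2c₁₃), (−2c₁₂, 2, −2c₂₃·x), (−2c₁₃, −2c₂₃·x^{−1}, 2). Then the ratio of the two cyclic products of the circuit (1,2,3) satisfies (A(x)₁₂ · A(x)₂₃ · A(x)₃₁) / (A(x)₁₃ · A(x)₃₂ · A(x)₂₁) = x², so the normalized cyclic product R_{(1,2,3)}(A(x)) = log(x²) = 2·log x; in particular the map x ↦ R_{(1,2,3)}(A(x)) is a bijection from (0, ∞) onto ℝ. -/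
theorem cos_pi_div_natCast_pos {m : ℕ} (hm : 3 ≤ m) : 0 < Real.cos (Real.pi / m) := by
  have hm' : (2 : ℝ) < m := by exact_mod_cast hm
  have hpos : 0 < Real.pi / m := div_pos Real.pi_pos (by linarith)
  exact Real.cos_pos_of_mem_Ioo ⟨by linarith [Real.pi_pos],
    div_lt_div_of_pos_left Real.pi_pos two_pos hm'⟩

/-- proof of Theorem 3.1(1) of the paper. For the
one-parameter family of Cartan matrices of a perfect labeled triangle with no
right angle, the ratio of the two cyclic products of the circuit `(1,2,3)` is
`x²`, the normalized cyclic product is `2 log x`, and the map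
`x ↦ R_{(1,2,3)}(A(x))` is a bijection from `(0, ∞)` onto `ℝ`.
(Indices `1,2,3` are represented by `0,1,2 : Fin 3`.) -/
theorem triangle_normalized_cyclic_product_param
    (m12 m13 m23 : ℕ) (h12 : 3 ≤ m12) (h13 : 3 ≤ m13) (h23 : 3 ≤ m23)
    (c12 c13 c23 : ℝ)
    (hc12 : c12 = Real.cos (Real.pi / m12))
    (hc13 : c13 = Real.cos (Real.pi / m13))
    (hc23 : c23 = Real.cos (Real.pi / m23))
    (A : ℝ → Matrix (Fin 3) (Fin 3) ℝ)
    (hA : ∀ x : ℝ, A x =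
      !![2, -2 * c12, -2 * c13;
         -2 * c12, 2, -2 * c23 * x;
         -2 * c13, -2 * c23 * x⁻¹, 2]) :
    (∀ x : ℝ, 0 < x →
      (A x 0 1 * A x 1 2 * A x 2 0) / (A x 0 2 * A x 2 1 * A x 1 0) = x ^ 2 ∧
      Real.log ((A x 0 1 * A x 1 2 * A x 2 0) / (A x 0 2 * A x 2 1 * A x 1 0)) =
        2 * Real.log x) ∧
    Set.BijOn
      (fun x : ℝ => Real.log
        ((A x 0 1 * A x 1 2 * A x 2 0) / (A x 0 2 * A x 2 1 * A x 1 0)))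
      (Set.Ioi 0) Set.univ := by
  have ne12 : c12 ≠ 0 := hc12 ▸ (cos_pi_div_natCast_pos h12).ne'
  have ne13 : c13 ≠ 0 := hc13 ▸ (cos_pi_div_natCast_pos h13).ne'
  have ne23 : c23 ≠ 0 := hc23 ▸ (cos_pi_div_natCast_pos h23).ne'
  have ratio : ∀ x : ℝ, 0 < x →
      (A x 0 1 * A x 1 2 * A x 2 0) / (A x 0 2 * A x 2 1 * A x 1 0) = x ^ 2 := by
    intro x hx
    have hx0 : x ≠ 0 := hx.ne'
    simp only [hA, Matrix.of_apply, Matrix.cons_val]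
    field_simp
  have log_ratio : ∀ x : ℝ, 0 < x →
      Real.log ((A x 0 1 * A x 1 2 * A x 2 0) / (A x 0 2 * A x 2 1 * A x 1 0)) =
        2 * Real.log x := by
    intro x hx
    rw [ratio x hx, Real.log_pow, Nat.cast_ofNat]
  refine ⟨fun x hx => ⟨ratio x hx, log_ratio x hx⟩, fun _ _ => Set.mem_univ _, ?_, ?_⟩
  · intro x hx y hy hxy
    simp only [log_ratio x hx, log_ratio y hy] at hxy
    exact Real.log_injOn_pos hx hy (by linarith)
  · intro y _
    refine ⟨Real.exp (y / 2), Real.exp_pos _, ?_⟩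
    simp only [log_ratio _ (Real.exp_pos _), Real.log_exp]
    ring
end

section
/- There exist infinitely many pairwise non-equivalent 3×3 real matrices A = (a_{ij}) (indexed by {1,2,3}) satisfying: a_{ii} = 2 for all i; a_{ij} < 0 for all i ≠ j; a₁₂·a₂₁ = 1 and a₂₃·a₃₂ = 1; a₁₃·a₃₁ ≥ 4; and every cyclic product of A is an integer. More precisely, there is an injective map from ℕ into the set of such matrices whose images are pairwise non-equivalent, where two matrices A, A' are equivalent if A' = D A D^{-1} for some diagonal matrix D with strictly positive diagonal entries. -/
open scoped BigOperators

/-- The integral Cartan matrix with unit 2-cyclic products along two edges and 2-cyclic product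
`n + 4` along the third. -/
def triangleCartanMatrix (n : ℕ) : Matrix (Fin 3) (Fin 3) ℤ :=
  !![2, -1, -(n + 4); -1, 2, -1; -1, -1, 2]

/-- The 2-cyclic products of a matrix are invariant under diagonal conjugation. -/
lemma mul_apply_swap_eq_of_diagonal_conj {ι K : Type*} [Field K] {A B : Matrix ι ι K} {d : ι → K}
    (hd : ∀ i, d i ≠ 0) (h : ∀ i j, A i j = d i * B i j * (d j)⁻¹) (i j : ι) :
    A i j * A j i = B i j * B j i := by
  have hi := hd i
  have hj := hd j
  rw [h i j, h j i]
  field_simp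

/-- matrix-level content of Remark 5.3 of the paper. There
are infinitely many pairwise non-equivalent 3×3 Cartan matrices of a large,
2-perfect but non-perfect labeled triangle (two edges labeled 3, one edge
labeled ∞) all of whose cyclic products are integers.
(Indices `1,2,3` are represented by `0,1,2 : Fin 3`.) -/
theorem infinitely_many_integral_triangle_cartan_matrices :
    ∃ f : ℕ → Matrix (Fin 3) (Fin 3) ℝ,
      Function.Injective f ∧
      (∀ n : ℕ,
        (∀ i, f n i i = 2) ∧
        (∀ i j, i ≠ j → f n i j < 0) ∧
        f n 0 1 * f n 1 0 = 1 ∧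
        f n 1 2 * f n 2 1 = 1 ∧
        4 ≤ f n 0 2 * f n 2 0 ∧
        (∀ (k : ℕ) (C : Fin (k + 1) → Fin 3), ∃ z : ℤ,
          (∏ j : Fin (k + 1), f n (C j) (C (j + 1))) = z)) ∧
      (∀ a b : ℕ, a ≠ b →
        ¬ ∃ d : Fin 3 → ℝ, (∀ i, 0 < d i) ∧
          ∀ i j, f a i j = d i * f b i j * (d j)⁻¹) := by
  have entry_eq (n : ℕ) : (triangleCartanMatrix n).map ((↑) : ℤ → ℝ) 0 2 *
      (triangleCartanMatrix n).map ((↑) : ℤ → ℝ) 2 0 = n + 4 := by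
    simp [triangleCartanMatrix]
  refine ⟨fun n => (triangleCartanMatrix n).map (↑), fun a b hab => ?_, fun n =>
    ⟨fun i => ?_, fun i j hij => ?_, ?_, ?_, ?_, fun k C =>
      ⟨∏ j, triangleCartanMatrix n (C j) (C (j + 1)), ?_⟩⟩, ?_⟩
  · have h := entry_eq a
    rw [show (triangleCartanMatrix a).map ((↑) : ℤ → ℝ) = _ from hab, entry_eq b] at h
    exact_mod_cast (add_right_cancel h).symm
  · fin_cases i <;> simp [triangleCartanMatrix]
  · have : triangleCartanMatrix n i j < 0 := by
      fin_cases i <;> fin_cases j <;> simp [triangleCartanMatrix] at hij ⊢ <;> omega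
    exact Int.cast_lt_zero.2 this
  · simp [triangleCartanMatrix]
  · simp [triangleCartanMatrix]
  · rw [entry_eq]
    linarith [n.cast_nonneg (α := ℝ)]
  · simp
  · rintro a b hab ⟨d, hd, h⟩
    have key := mul_apply_swap_eq_of_diagonal_conj (fun i => (hd i).ne') h 0 2
    rw [entry_eq, entry_eq] at key
    exact hab (by exact_mod_cast add_right_cancel key)
end

section
/- Let α₁, α₂, b₁, b₂ ∈ ℝ², suppose ⟨α₁, b₁⟩ = 2 and ⟨α₂, b₂⟩ = 2, and suppose ⟨α₁, b₂⟩·⟨α₂, b₁⟩ = 4·cos²(π/m) for some natural number m ≥ 3, where ⟨α, b⟩ = α₁b₁ + α₂b₂ is the standard pairing. Set σᵢ = Id₂ − bᵢ αᵢᵀ (a 2×2 real matrix, where b αᵀ is the rank-one matrix with entries b_p α_q). Then (σ₁ σ₂)^m = Id₂. -/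
open scoped BigOperators

namespace Matrix

/-- The Cayley–Hamilton theorem for `2 × 2` matrices. -/
theorem sq_eq_trace_smul_sub_det_smul_one {R : Type*} [CommRing R] (A : Matrix (Fin 2) (Fin 2) R) :
    A ^ 2 = A.trace • A - A.det • (1 : Matrix (Fin 2) (Fin 2) R) := by
  ext i j
  fin_cases i <;> fin_cases j <;>
    simp [sq, mul_apply, trace_fin_two, det_fin_two, Fin.sum_univ_two] <;> ring

/-- Powers of a unimodular `2 × 2` matrix with trace `2 cos θ`. -/
theorem sin_smul_pow_succ_of_trace_eq_two_mul_cos {A : Matrix (Fin 2) (Fin 2) ℝ} {θ : ℝ}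
    (hdet : A.det = 1) (htrace : A.trace = 2 * Real.cos θ) (n : ℕ) :
    Real.sin θ • A ^ (n + 1) =
      Real.sin ((n + 1) * θ) • A - Real.sin (n * θ) • (1 : Matrix (Fin 2) (Fin 2) ℝ) := by
  induction n with
  | zero => simp
  | succ n ih =>
    have hsin : Real.sin ((n + 1 + 1) * θ) =
        2 * Real.cos θ * Real.sin ((n + 1) * θ) - Real.sin (n * θ) := by
      rw [show ((n : ℝ) + 1 + 1) * θ = (n + 1) * θ + θ by ring,
        show (n : ℝ) * θ = (n + 1) * θ - θ by ring, Real.sin_add, Real.sin_sub]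
      ring
    rw [pow_succ, ← smul_mul_assoc, ih, sub_mul, smul_mul_assoc, smul_mul_assoc, one_mul, ← sq,
      sq_eq_trace_smul_sub_det_smul_one, hdet, htrace]
    push_cast
    rw [hsin]
    module

/-- A unimodular `2 × 2` matrix with trace `2 cos (2π / m)` has order dividing `m`. -/
theorem pow_eq_one_of_trace_eq_two_mul_cos {A : Matrix (Fin 2) (Fin 2) ℝ} {m : ℕ} (hm : 3 ≤ m)
    (hdet : A.det = 1) (htrace : A.trace = 2 * Real.cos (2 * Real.pi / m)) : A ^ m = 1 := by
  obtain ⟨n, rfl⟩ : ∃ n, m = n + 1 := ⟨m - 1, by omega⟩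
  have hm' : (3 : ℝ) ≤ (n + 1 : ℕ) := by exact_mod_cast hm
  have hpos : (0 : ℝ) < (n + 1 : ℕ) := by linarith
  set θ : ℝ := 2 * Real.pi / (n + 1 : ℕ) with hθ
  have hmul : ((n : ℝ) + 1) * θ = 2 * Real.pi := by
    rw [hθ]
    push_cast at hpos ⊢
    field_simp
  have hsin : Real.sin θ ≠ 0 := by
    refine (Real.sin_pos_of_pos_of_lt_pi (div_pos Real.two_pi_pos hpos) ?_).ne'
    rw [div_lt_iff₀ hpos]
    nlinarith [Real.pi_pos]
  have hpow := sin_smul_pow_succ_of_trace_eq_two_mul_cos hdet htrace n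
  rw [hmul, show (n : ℝ) * θ = 2 * Real.pi - θ by linarith, Real.sin_two_pi_sub,
    Real.sin_two_pi, zero_smul, zero_sub, neg_smul, neg_neg] at hpow
  exact smul_right_injective _ hsin hpow

end Matrix

/-- case (3) of Vinberg's Proposition 6, as displayed in
Section 2 of the paper. For projective reflections `σᵢ = Id − bᵢ αᵢᵀ` on `ℝ²`
with `⟨αᵢ, bᵢ⟩ = 2` and `⟨α₁, b₂⟩⟨α₂, b₁⟩ = 4cos²(π/m)` for some `m ≥ 3`,
the product `σ₁ σ₂` satisfies the dihedral relation `(σ₁ σ₂)^m = Id`. -/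
theorem reflections_product_pow_eq_one
    (α₁ α₂ b₁ b₂ : Fin 2 → ℝ)
    (h₁ : ∑ p, α₁ p * b₁ p = 2) (h₂ : ∑ p, α₂ p * b₂ p = 2)
    (m : ℕ) (hm : 3 ≤ m)
    (h : (∑ p, α₁ p * b₂ p) * (∑ p, α₂ p * b₁ p) =
      4 * Real.cos (Real.pi / m) ^ 2) :
    ((1 - Matrix.vecMulVec b₁ α₁) * (1 - Matrix.vecMulVec b₂ α₂)) ^ m =
      (1 : Matrix (Fin 2) (Fin 2) ℝ) := by
  have hcos : Real.cos (2 * Real.pi / m) = 2 * Real.cos (Real.pi / m) ^ 2 - 1 := by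
    rw [mul_div_assoc, Real.cos_two_mul]
  simp only [Fin.sum_univ_two] at h₁ h₂ h
  apply Matrix.pow_eq_one_of_trace_eq_two_mul_cos hm
  · have hdet (a b : Fin 2 → ℝ) (hab : a 0 * b 0 + a 1 * b 1 = 2) :
        (1 - Matrix.vecMulVec b a).det = -1 := by
      simp only [Matrix.det_fin_two, Matrix.sub_apply, Matrix.vecMulVec_apply, Matrix.one_apply]
      simp
      linear_combination -hab
    rw [Matrix.det_mul, hdet _ _ h₁, hdet _ _ h₂]
    norm_num
  · rw [hcos]
    simp [Matrix.trace_fin_two, Matrix.mul_apply, Fin.sum_univ_two, Matrix.vecMulVec_apply]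
    linear_combination h - h₁ - h₂
end
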